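/- arXiv:1812.11908 — 3 statements merged into one kernel-verified Lean document; each statement's English description precedes it below -/
import Mathlib

section
/- Let m ≥ 1 be an integer, λ_0, …, λ_{m−1} real numbers, q > 0, and let L ∈ ℝ satisfy L > 0, L > λ_i for every i, and ∏_{i=0}^{m−1}(L − λ_i) = (mL)^m q. Fix an index i and an integer k ≥ 2. Then the k-th derivative at t = L − λ_i of the one-variable function t ↦ W(x_0, …, x_{i−1}, t, x_{i+1}, …, x_{m−1}), where the other coordinates are fixed at x_j = L − λ_j, equals (L − λ_i)^{−k} · ( (−1)^{k−1}(k−1)!·λ_i − mL·∏_{j=0}^{k−1}(1/m − j) ). -/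
lemma iteratedDeriv_real_log_succ (n : ℕ) (x : ℝ) :
    iteratedDeriv (n + 1) Real.log x = (-1) ^ n * (n.factorial : ℝ) * x ^ (-1 - n : ℤ) := by
  rw [iteratedDeriv_succ', Real.deriv_log', iteratedDeriv_eq_iterate]
  exact iter_deriv_inv n x

lemma iteratedDeriv_rpow_const {x : ℝ} (hx : 0 < x) (r : ℝ) (n : ℕ) :
    iteratedDeriv n (fun t : ℝ => t ^ r) x =
      x ^ r * x ^ (-(n : ℤ)) * ∏ j ∈ Finset.range n, (r - (j : ℝ)) := by
  rw [iteratedDeriv_eq_iterate, Real.iter_deriv_rpow_const, descPochhammer_eval_eq_prod_range,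
    Real.rpow_sub_natCast hx.ne', zpow_neg, zpow_natCast]
  ring

lemma iteratedDeriv_affine_add_log_sub_rpow {x : ℝ} (hx : 0 < x) (a b c r : ℝ) {k : ℕ}
    (hk : 2 ≤ k) :
    iteratedDeriv k (fun t : ℝ => (t + a) + b * Real.log t - c * t ^ r) x =
      x ^ (-(k : ℤ)) * ((-1) ^ (k - 1) * ((k - 1).factorial : ℝ) * b -
        c * x ^ r * ∏ j ∈ Finset.range k, (r - (j : ℝ))) := by
  obtain ⟨n, rfl⟩ := Nat.exists_eq_add_of_le' hk
  have hlog : ContDiffAt ℝ ((n + 2 : ℕ) : WithTop ℕ∞) (fun t => b * Real.log t) x :=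
    contDiffAt_const.mul (Real.contDiffAt_log.2 hx.ne')
  have hrpow : ContDiffAt ℝ ((n + 2 : ℕ) : WithTop ℕ∞) (fun t : ℝ => c * t ^ r) x :=
    contDiffAt_const.mul (Real.contDiffAt_rpow_const_of_ne hx.ne')
  have haff : ContDiffAt ℝ ((n + 2 : ℕ) : WithTop ℕ∞) (fun t : ℝ => t + a) x := by fun_prop
  have haff_zero : iteratedDeriv (n + 2) (fun t : ℝ => t + a) x = 0 := by
    have hderiv : deriv (fun t : ℝ => t + a) = fun _ => 1 := by ext; simp
    rw [iteratedDeriv_succ', hderiv, iteratedDeriv_const]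
    simp
  rw [iteratedDeriv_fun_sub (haff.add hlog) hrpow, iteratedDeriv_fun_add haff hlog, haff_zero,
    iteratedDeriv_const_mul_field, iteratedDeriv_const_mul_field, iteratedDeriv_real_log_succ,
    iteratedDeriv_rpow_const hx]
  have hexp : (-1 - (n + 1 : ℕ) : ℤ) = -((n + 2 : ℕ) : ℤ) := by push_cast; ring
  rw [hexp, show n + 2 - 1 = n + 1 from rfl]
  ring


/-- The Landau–Ginzburg potential of the total space of `O(−m)` over `ℙ^{m−1}`:
`W(x) = Σᵢ(xᵢ + λᵢ ln xᵢ) − (q⁻¹ ∏ᵢ xᵢ)^{1/m}`. -/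
noncomputable def LGpotential (m : ℕ) (lam : Fin m → ℝ) (q : ℝ) (x : Fin m → ℝ) : ℝ :=
  (∑ i, (x i + lam i * Real.log (x i))) - (q⁻¹ * ∏ i, x i) ^ ((1 : ℝ) / m)

/-- Let `L` solve the indicial equation `∏ᵢ(L − λᵢ) = (mL)^m q` (with `L > 0`, `L > λᵢ`,
`q > 0`).  For any index `i` and any `k ≥ 2`, the `k`-th derivative at `t = L − λᵢ` of the
one-variable function `t ↦ W(x₀, …, t, …, x_{m−1})` (other coordinates fixed at `x_j = L − λ_j`)
equals `(L − λᵢ)^{−k}·((−1)^{k−1}(k−1)!·λᵢ − mL·∏_{j=0}^{k−1}(1/m − j))`. -/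
theorem LG_higher_derivatives (m : ℕ) (hm : 1 ≤ m) (lam : Fin m → ℝ) (q : ℝ) (hq : 0 < q)
    (L : ℝ) (hL : 0 < L) (hLlam : ∀ i, lam i < L)
    (hind : ∏ i, (L - lam i) = ((m : ℝ) * L) ^ m * q)
    (i : Fin m) (k : ℕ) (hk : 2 ≤ k) :
    iteratedDeriv k
        (fun t => LGpotential m lam q (Function.update (fun j => L - lam j) i t))
        (L - lam i) =
      (L - lam i) ^ (-(k : ℤ)) *
        ((-1 : ℝ) ^ (k - 1) * (Nat.factorial (k - 1) : ℝ) * lam i -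
          (m : ℝ) * L * ∏ j ∈ Finset.range k, ((1 : ℝ) / m - (j : ℝ))) := by
  have hxi : 0 < L - lam i := sub_pos.2 (hLlam i)
  set P : ℝ := ∏ j ∈ Finset.univ \ {i}, (L - lam j) with hP
  have hP_pos : 0 < P := Finset.prod_pos fun j _ => sub_pos.2 (hLlam j)
  have hprod : (L - lam i) * P = ((m : ℝ) * L) ^ m * q := by
    rw [← hind, ← Finset.prod_update_of_mem (Finset.mem_univ i), Function.update_eq_self]
  have hcrit : (q⁻¹ * P) ^ ((1 : ℝ) / m) * (L - lam i) ^ ((1 : ℝ) / m) = m * L := by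
    have hval : q⁻¹ * P * (L - lam i) = ((m : ℝ) * L) ^ m := by
      rw [mul_assoc, mul_comm P, hprod]
      field_simp
    rw [← Real.mul_rpow (by positivity) hxi.le, hval, one_div,
      Real.pow_rpow_inv_natCast (by positivity) (by lia)]
  obtain ⟨a, ha⟩ : ∃ a : ℝ, ∀ t, ∑ j, (Function.update (fun j => L - lam j) i t j +
      lam j * Real.log (Function.update (fun j => L - lam j) i t j)) =
        (t + a) + lam i * Real.log t := by
    refine ⟨∑ j ∈ Finset.univ.erase i, ((L - lam j) + lam j * Real.log (L - lam j)), fun t => ?_⟩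
    rw [← Finset.add_sum_erase _ _ (Finset.mem_univ i), Function.update_self,
      Finset.sum_congr rfl fun j hj => by rw [Function.update_of_ne (Finset.ne_of_mem_erase hj)]]
    ring
  have hW : (fun t => LGpotential m lam q (Function.update (fun j => L - lam j) i t)) =ᶠ[
      nhds (L - lam i)] fun t => (t + a) + lam i * Real.log t -
        (q⁻¹ * P) ^ ((1 : ℝ) / m) * t ^ ((1 : ℝ) / m) := by
    filter_upwards [lt_mem_nhds hxi] with t ht
    rw [LGpotential, ha, Finset.prod_update_of_mem (Finset.mem_univ i), ← hP, mul_comm t,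
      ← mul_assoc, Real.mul_rpow (by positivity) ht.le]
  rw [hW.iteratedDeriv_eq, iteratedDeriv_affine_add_log_sub_rpow hxi _ _ _ _ hk, hcrit]
end

section
/- Let m ≥ 1 be an integer, λ_0, …, λ_{m−1} complex numbers, and L ∈ ℂ with L ≠ λ_i for all i. Let Q be the m×m matrix with entries Q_{ij} = δ_{ij}/(L − λ_i) − L/(m·(L − λ_i)(L − λ_j)). Then det Q = ( Σ_{j=0}^{m−1} (−1)^{m−j}(m−j) e_{m−j} L^j ) / ( m·∏_{i=0}^{m−1}(L − λ_i)² ), where e_k denotes the k-th elementary symmetric polynomial in λ_0, …, λ_{m−1}. Equivalently, writing f(T) = ∏_{i}(T − λ_i), one has det Q = (m·f(L) − L·f′(L)) / (m·f(L)²). -/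
/-- The `k`-th elementary symmetric polynomial in `λ₀, …, λ_{m−1}`. -/
noncomputable def esymmC {m : ℕ} (lam : Fin m → ℂ) (k : ℕ) : ℂ :=
  ∑ t ∈ (Finset.univ : Finset (Fin m)).powersetCard k, ∏ i ∈ t, lam i

/-- The Hessian matrix of the Landau–Ginzburg potential at its critical point:
`Q_{ij} = δ_{ij}/(L − λᵢ) − L/(m·(L − λᵢ)(L − λ_j))`. -/
noncomputable def hessianQ (m : ℕ) (lam : Fin m → ℂ) (L : ℂ) : Matrix (Fin m) (Fin m) ℂ :=
  Matrix.of fun i j =>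
    (if i = j then 1 else 0) / (L - lam i) - L / ((m : ℂ) * (L - lam i) * (L - lam j))

open Polynomial in
/-- For `p` of degree at most `n`, the polynomial `n p - X p'` has coefficients `(n - j) pⱼ`. -/
theorem natCast_mul_eval_sub_mul_eval_derivative {R : Type*} [CommRing R] (p : R[X]) {n : ℕ}
    (hp : p.natDegree ≤ n) (x : R) :
    (n : R) * p.eval x - x * (derivative p).eval x =
      ∑ j ∈ Finset.range n, ((n - j : ℕ) : R) * p.coeff j * x ^ j := by
  have hcoeff (j : ℕ) :
      (C (n : R) * p - X * derivative p).coeff j = ((n : R) - j) * p.coeff j := by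
    cases j with
    | zero => simp
    | succ k =>
      rw [coeff_sub, coeff_C_mul, coeff_X_mul, coeff_derivative]
      push_cast
      ring
  have hdeg : (C (n : R) * p - X * derivative p).natDegree < n + 1 := by
    refine Nat.lt_succ_of_le (natDegree_le_iff_coeff_eq_zero.mpr fun j hj => ?_)
    rw [hcoeff, coeff_eq_zero_of_natDegree_lt (hp.trans_lt hj), mul_zero]
  have heval := eval_eq_sum_range' hdeg x
  simp only [eval_sub, eval_mul, eval_C, eval_X, hcoeff] at heval
  rw [heval, Finset.sum_range_succ, sub_self, zero_mul, zero_mul, add_zero]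
  refine Finset.sum_congr rfl fun j hj => ?_
  rw [Nat.cast_sub (Finset.mem_range.mp hj).le]

theorem coeff_prod_X_sub_C_eq_esymmC {m : ℕ} (lam : Fin m → ℂ) {j : ℕ} (hj : j ≤ m) :
    (∏ i, (Polynomial.X - Polynomial.C (lam i))).coeff j =
      (-1) ^ (m - j) * esymmC lam (m - j) := by
  have h := Multiset.prod_X_sub_C_coeff ((Finset.univ : Finset (Fin m)).val.map lam)
    (k := j) (by simpa using hj)
  rw [Finset.esymm_map_val, Multiset.map_map, Multiset.card_map, Finset.card_val,
    Finset.card_univ, Fintype.card_fin] at h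
  exact h

/-- The Hessian is a diagonal matrix times a rank-one perturbation of the identity. -/
theorem det_hessianQ (m : ℕ) (lam : Fin m → ℂ) (L : ℂ) :
    (hessianQ m lam L).det =
      (∏ i, (L - lam i)⁻¹) * (1 - L / m * ∑ i, (L - lam i)⁻¹) := by
  have hfactor : hessianQ m lam L = Matrix.diagonal (fun i => (L - lam i)⁻¹) *
      (1 + Matrix.replicateCol Unit (fun _ => -(L / m)) *
        Matrix.replicateRow Unit (fun i => (L - lam i)⁻¹)) := by
    ext i j
    rw [Matrix.diagonal_mul]
    simp only [hessianQ, Matrix.of_apply, Matrix.add_apply, Matrix.one_apply, Matrix.mul_apply,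
      Matrix.replicateCol_apply, Matrix.replicateRow_apply, Finset.univ_unique,
      Finset.sum_singleton, div_eq_mul_inv, mul_inv]
    ring
  rw [hfactor, Matrix.det_mul, Matrix.det_diagonal,
    Matrix.det_one_add_replicateCol_mul_replicateRow]
  simp only [dotProduct, ← Finset.sum_mul]
  ring

open Polynomial in
theorem eval_derivative_prod_X_sub_C {m : ℕ} (lam : Fin m → ℂ) (L : ℂ) (hL : ∀ i, L ≠ lam i) :
    (derivative (∏ i, (X - C (lam i)))).eval L =
      (∏ i, (L - lam i)) * ∑ i, (L - lam i)⁻¹ := by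
  rw [derivative_prod_finset, eval_finsetSum, Finset.mul_sum]
  refine Finset.sum_congr rfl fun i _ => ?_
  rw [← Finset.mul_prod_erase _ _ (Finset.mem_univ i)]
  simp only [derivative_X_sub_C, mul_one, eval_prod, eval_sub, eval_X, eval_C]
  field_simp [sub_ne_zero.mpr (hL i)]

/-- `det Q = (Σ_{j=0}^{m−1}(−1)^{m−j}(m−j)e_{m−j}L^j)/(m·∏ᵢ(L−λᵢ)²)`; equivalently, with
`f(T) = ∏ᵢ(T − λᵢ)`, `det Q = (m·f(L) − L·f′(L))/(m·f(L)²)`. -/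
theorem hessian_det (m : ℕ) (hm : 1 ≤ m) (lam : Fin m → ℂ) (L : ℂ)
    (hL : ∀ i, L ≠ lam i) :
    (hessianQ m lam L).det =
        (∑ j ∈ Finset.range m,
            (-1 : ℂ) ^ (m - j) * ((m - j : ℕ) : ℂ) * esymmC lam (m - j) * L ^ j) /
          ((m : ℂ) * ∏ i, (L - lam i) ^ 2) ∧
      (hessianQ m lam L).det =
        ((m : ℂ) * (∏ i, (Polynomial.X - Polynomial.C (lam i)) : Polynomial ℂ).eval L -
            L * (Polynomial.derivative
              (∏ i, (Polynomial.X - Polynomial.C (lam i)) : Polynomial ℂ)).eval L) /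
          ((m : ℂ) * ((∏ i, (Polynomial.X - Polynomial.C (lam i)) : Polynomial ℂ).eval L) ^ 2) := by
  have hm0 : (m : ℂ) ≠ 0 := Nat.cast_ne_zero.mpr (Nat.one_le_iff_ne_zero.mp hm)
  have hprod : ∏ i, (L - lam i) ≠ 0 :=
    Finset.prod_ne_zero_iff.mpr fun i _ => sub_ne_zero.mpr (hL i)
  have heval : (∏ i, (Polynomial.X - Polynomial.C (lam i))).eval L = ∏ i, (L - lam i) := by
    simp [Polynomial.eval_prod]
  have hdet : (hessianQ m lam L).det =
      ((m : ℂ) * (∏ i, (Polynomial.X - Polynomial.C (lam i)) : Polynomial ℂ).eval L -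
          L * (Polynomial.derivative
            (∏ i, (Polynomial.X - Polynomial.C (lam i)) : Polynomial ℂ)).eval L) /
        ((m : ℂ) * ((∏ i, (Polynomial.X - Polynomial.C (lam i)) : Polynomial ℂ).eval L) ^ 2) := by
    rw [det_hessianQ, eval_derivative_prod_X_sub_C lam L hL, heval, Finset.prod_inv_distrib]
    field_simp
  refine ⟨?_, hdet⟩
  rw [hdet, natCast_mul_eval_sub_mul_eval_derivative _ (n := m) (by simp), heval,
    Finset.prod_pow]
  congr 1
  refine Finset.sum_congr rfl fun j hj => ?_
  rw [coeff_prod_X_sub_C_eq_esymmC lam (Finset.mem_range.mp hj).le]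
  ring
end

section
/- Let m ≥ 1 be an integer, ζ ∈ ℂ a primitive m-th root of unity, λ ∈ ℂ nonzero, and L ∈ ℂ with L^m ≠ λ^m. Set λ_i = ζ^i λ for i = 0, …, m−1 and let Q be the m×m matrix with entries Q_{ij} = δ_{ij}/(L − λ_i) − L/(m·(L − λ_i)(L − λ_j)). Then det Q = −λ^m/(L^m − λ^m)². In particular, det Q⁻¹ = −(L^m − λ^m)²/λ^m is, up to sign, the expression (L^m − λ^m)²/λ^m and depends on L and λ only through L^m and λ^m. -/
open Polynomial in
/-- The `m`-th roots `ζ ^ i * a` of `a ^ m` factor `x ^ m - a ^ m`. -/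
theorem IsPrimitiveRoot.prod_sub_pow_mul_eq {m : ℕ} (hm : 0 < m) {ζ : ℂ}
    (hζ : IsPrimitiveRoot ζ m) (a x : ℂ) :
    ∏ i : Fin m, (x - ζ ^ (i : ℕ) * a) = x ^ m - a ^ m := by
  have h := congrArg (eval x) (X_pow_sub_C_eq_prod hζ hm (rfl : a ^ m = a ^ m))
  rw [eval_prod] at h
  simpa [Fin.prod_univ_eq_prod_range fun i => x - ζ ^ i * a] using h.symm

/-- The logarithmic derivative of `x ^ m - a ^ m`, as a sum over the roots. -/
theorem IsPrimitiveRoot.sum_inv_sub_pow_mul_eq {m : ℕ} (hm : 0 < m) {ζ : ℂ}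
    (hζ : IsPrimitiveRoot ζ m) {a x : ℂ} (hx : x ^ m ≠ a ^ m) :
    ∑ i : Fin m, (x - ζ ^ (i : ℕ) * a)⁻¹ = m * x ^ (m - 1) / (x ^ m - a ^ m) := by
  have hprod := hζ.prod_sub_pow_mul_eq hm a x
  have hne : ∀ i ∈ Finset.univ, x - ζ ^ ((i : Fin m) : ℕ) * a ≠ 0 :=
    Finset.prod_ne_zero_iff.mp (hprod ▸ sub_ne_zero.mpr hx)
  have h := logDeriv_prod (s := Finset.univ) (f := fun (i : Fin m) y => y - ζ ^ (i : ℕ) * a)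
    (x := x) hne (fun i _ => by fun_prop)
  have hfun : (fun y => ∏ i : Fin m, (y - ζ ^ (i : ℕ) * a)) = fun y => y ^ m - a ^ m :=
    funext (hζ.prod_sub_pow_mul_eq hm a)
  simpa [hfun, logDeriv_apply] using h.symm

/-- The determinant of a rank-one perturbation of an inverse diagonal matrix. -/
theorem Matrix.det_inv_diagonal_sub_rank_one {n K : Type*} [Fintype n] [DecidableEq n] [Field K]
    (d : n → K) (c : K) :
    (Matrix.of fun i j : n => (if i = j then (1 : K) else 0) / d i - c / (d i * d j)).det =
      (∏ i, d i)⁻¹ * (1 - c * ∑ i, (d i)⁻¹) := by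
  have h : (Matrix.of fun i j : n => (if i = j then (1 : K) else 0) / d i - c / (d i * d j)) =
      diagonal (fun i => (d i)⁻¹) *
        (1 + replicateCol Unit (fun _ => -c) * replicateRow Unit fun j => (d j)⁻¹) := by
    ext i j
    rw [diagonal_mul]
    simp only [of_apply, add_apply, one_apply, mul_apply, replicateCol_apply,
      replicateRow_apply, Finset.univ_unique, Finset.sum_singleton, div_eq_mul_inv, mul_inv]
    ring
  rw [h, det_mul, det_diagonal, det_one_add_replicateCol_mul_replicateRow, Finset.prod_inv_distrib]
  simp [dotProduct, sub_eq_add_neg, mul_comm, Finset.mul_sum]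

/-- Under the formal-quintic specialization `λᵢ = ζ^i λ` (`ζ` a primitive `m`-th root of
unity, `λ ≠ 0`, `L^m ≠ λ^m`), the determinant of the Hessian matrix
`Q_{ij} = δ_{ij}/(L − λᵢ) − L/(m(L − λᵢ)(L − λ_j))` equals `−λ^m/(L^m − λ^m)²`. -/
theorem hessian_det_special (m : ℕ) (hm : 1 ≤ m) (ζ lam L : ℂ)
    (hζ : IsPrimitiveRoot ζ m) (hlam : lam ≠ 0) (hLlam : L ^ m ≠ lam ^ m) :
    (Matrix.of fun i j : Fin m =>
        (if i = j then (1 : ℂ) else 0) / (L - ζ ^ (i : ℕ) * lam) -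
          L / ((m : ℂ) * (L - ζ ^ (i : ℕ) * lam) * (L - ζ ^ (j : ℕ) * lam))).det =
      -lam ^ m / (L ^ m - lam ^ m) ^ 2 := by
  have hm0 : (m : ℂ) ≠ 0 := Nat.cast_ne_zero.mpr (by omega)
  have hne : L ^ m - lam ^ m ≠ 0 := sub_ne_zero.mpr hLlam
  have hpow : L * L ^ (m - 1) = L ^ m := mul_pow_sub_one (by omega) L
  have h := Matrix.det_inv_diagonal_sub_rank_one (fun i : Fin m => L - ζ ^ (i : ℕ) * lam) (L / m)
  simp only [div_div, ← mul_assoc] at h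
  rw [h, hζ.prod_sub_pow_mul_eq hm, hζ.sum_inv_sub_pow_mul_eq hm hLlam]
  field_simp
  rw [hpow]
  ring
end
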